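/- Let 𝖠 = A_sym, let v,u ∈ V with even geodesic distance r = d_G(v,u) > 0, and let the MPNN depth be m = r/2 with |σ'|≤1 and |σ''|≤1. Then for every input X and all coordinates 1≤α,β≤d, the mixed second derivative of the graph-level prediction satisfies |∂²y^{(m)}(X)/∂x_v^α∂x_u^β| ≤ (c₂ w)^r (A_sym^r)_{vu}. -/

import Mathlib

open scoped BigOperators

noncomputable section

namespace OSQ

variable {n d : ℕ}

/-- componentwise application of the activation function. -/
def act (σ : ℝ → ℝ) (x : EuclideanSpace ℝ (Fin d)) : EuclideanSpace ℝ (Fin d) :=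
  WithLp.toLp 2 (fun i => σ (x i))

/-- node features computed by the MPNN after `t` layers. -/
def mpnn (σ : ℝ → ℝ) (𝒜 : Matrix (Fin n) (Fin n) ℝ)
    (Ω W : ℕ → EuclideanSpace ℝ (Fin d) →L[ℝ] EuclideanSpace ℝ (Fin d))
    (ψ : ℕ → EuclideanSpace ℝ (Fin d) × EuclideanSpace ℝ (Fin d) → EuclideanSpace ℝ (Fin d)) :
    ℕ → (Fin n → EuclideanSpace ℝ (Fin d)) → Fin n → EuclideanSpace ℝ (Fin d)
  | 0, X, v => X v
  | (t+1), X, v =>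
    act σ (Ω (t+1) (mpnn σ 𝒜 Ω W ψ t X v)
      + W (t+1) (∑ u : Fin n, 𝒜 v u • ψ (t+1) (mpnn σ 𝒜 Ω W ψ t X v, mpnn σ 𝒜 Ω W ψ t X u)))

/-- coordinate direction in the input space: a perturbation of entry `β` of the
feature of node `u`. -/
def dir (u : Fin n) (β : Fin d) : Fin n → EuclideanSpace ℝ (Fin d) :=
  Pi.single u (EuclideanSpace.single β 1)

/-- `∂ h_v^{(m),α} / ∂ x_u^β`. -/
def jacEntry (σ : ℝ → ℝ) (𝒜 : Matrix (Fin n) (Fin n) ℝ)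
    (Ω W : ℕ → EuclideanSpace ℝ (Fin d) →L[ℝ] EuclideanSpace ℝ (Fin d))
    (ψ : ℕ → EuclideanSpace ℝ (Fin d) × EuclideanSpace ℝ (Fin d) → EuclideanSpace ℝ (Fin d))
    (m : ℕ) (v u : Fin n) (X : Fin n → EuclideanSpace ℝ (Fin d)) (α β : Fin d) : ℝ :=
  fderiv ℝ (fun Y => mpnn σ 𝒜 Ω W ψ m Y v α) X (dir u β)

/-- `∂² h_i^{(m),α} / ∂ x_v^β ∂ x_u^γ`. -/
def hessEntry (σ : ℝ → ℝ) (𝒜 : Matrix (Fin n) (Fin n) ℝ)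
    (Ω W : ℕ → EuclideanSpace ℝ (Fin d) →L[ℝ] EuclideanSpace ℝ (Fin d))
    (ψ : ℕ → EuclideanSpace ℝ (Fin d) × EuclideanSpace ℝ (Fin d) → EuclideanSpace ℝ (Fin d))
    (m : ℕ) (i v u : Fin n) (X : Fin n → EuclideanSpace ℝ (Fin d)) (α β γ : Fin d) : ℝ :=
  fderiv ℝ (fun Y => fderiv ℝ (fun Z => mpnn σ 𝒜 Ω W ψ m Z i α) Y (dir u γ)) X (dir v β)

/-- graph-level prediction with SUM readout: `y(X) = θᵀ Σ_v h_v^{(m)}`. -/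
def readout (θ : EuclideanSpace ℝ (Fin d)) (σ : ℝ → ℝ) (𝒜 : Matrix (Fin n) (Fin n) ℝ)
    (Ω W : ℕ → EuclideanSpace ℝ (Fin d) →L[ℝ] EuclideanSpace ℝ (Fin d))
    (ψ : ℕ → EuclideanSpace ℝ (Fin d) × EuclideanSpace ℝ (Fin d) → EuclideanSpace ℝ (Fin d))
    (m : ℕ) (X : Fin n → EuclideanSpace ℝ (Fin d)) : ℝ :=
  ∑ α : Fin d, θ α * (∑ v : Fin n, mpnn σ 𝒜 Ω W ψ m X v) α

/-- `∂² y^{(m)} / ∂ x_v^α ∂ x_u^β`. -/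
def mixEntry (θ : EuclideanSpace ℝ (Fin d)) (σ : ℝ → ℝ) (𝒜 : Matrix (Fin n) (Fin n) ℝ)
    (Ω W : ℕ → EuclideanSpace ℝ (Fin d) →L[ℝ] EuclideanSpace ℝ (Fin d))
    (ψ : ℕ → EuclideanSpace ℝ (Fin d) × EuclideanSpace ℝ (Fin d) → EuclideanSpace ℝ (Fin d))
    (m : ℕ) (v u : Fin n) (X : Fin n → EuclideanSpace ℝ (Fin d)) (α β : Fin d) : ℝ :=
  fderiv ℝ (fun Y => fderiv ℝ (fun Z => readout θ σ 𝒜 Ω W ψ m Z) Y (dir u β)) X (dir v α)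

/-- the matrix `S := (ω/w)I + c₁ diag(𝒜 1) + c₂ 𝒜`. -/
def Smat (ω w c₁ c₂ : ℝ) (𝒜 : Matrix (Fin n) (Fin n) ℝ) : Matrix (Fin n) (Fin n) ℝ :=
  (ω / w) • (1 : Matrix (Fin n) (Fin n) ℝ)
    + c₁ • Matrix.diagonal (fun i => ∑ j, 𝒜 i j) + c₂ • 𝒜

/-- `diag(𝒜 1)` : the diagonal matrix of row sums. -/
def rowSumDiag (𝒜 : Matrix (Fin n) (Fin n) ℝ) : Matrix (Fin n) (Fin n) ℝ :=
  Matrix.diagonal (fun i => ∑ j, 𝒜 i j)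

/-- `diag(1ᵀ M)` : the diagonal matrix of column sums. -/
def colSumDiag (M : Matrix (Fin n) (Fin n) ℝ) : Matrix (Fin n) (Fin n) ℝ :=
  Matrix.diagonal (fun j => ∑ i, M i j)

/-- the operator (spectral) norm of a matrix, viewed as a linear map between
Euclidean spaces. -/
def matOpNorm {ι κ : Type*} [Fintype ι] [Fintype κ] [DecidableEq ι] (M : Matrix κ ι ℝ) : ℝ :=
  ‖LinearMap.toContinuousLinearMap (Matrix.toEuclideanLin M)‖


/-- the symmetrically-normalized adjacency matrix `A_sym := D^{-1/2} A D^{-1/2}`. -/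
def Asym (G : SimpleGraph (Fin n)) [DecidableRel G.Adj] : Matrix (Fin n) (Fin n) ℝ :=
  Matrix.diagonal (fun a => (Real.sqrt (G.degree a))⁻¹) * G.adjMatrix ℝ *
    Matrix.diagonal (fun a => (Real.sqrt (G.degree a))⁻¹)

/-- the random-walk normalized adjacency matrix `D^{-1} A`. -/
def Arw (G : SimpleGraph (Fin n)) [DecidableRel G.Adj] : Matrix (Fin n) (Fin n) ℝ :=
  Matrix.diagonal (fun a => ((G.degree a : ℝ))⁻¹) * G.adjMatrix ℝ

/-- `f` does not depend on the feature of node `v`. -/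
def Indep {F : Type*} (f : (Fin n → EuclideanSpace ℝ (Fin d)) → F) (v : Fin n) : Prop :=
  ∀ Y Yb, (∀ k, k ≠ v → Y k = Yb k) → f Y = f Yb

lemma Indep.fderiv_apply {F : Type*} [NormedAddCommGroup F] [NormedSpace ℝ F]
    {f : (Fin n → EuclideanSpace ℝ (Fin d)) → F} {v : Fin n} (h : Indep f v)
    (a : Fin n → EuclideanSpace ℝ (Fin d)) : Indep (fun Y => fderiv ℝ f Y a) v := by
  intro Y Yb hY
  have h1 : (fun Z => f (Z + (Yb - Y))) = f := by
    funext Z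
    apply h
    intro k hk
    simp [hY k hk]
  have h2 := fderiv_comp_add_right (𝕜 := ℝ) (f := f) (x := Y) (Yb - Y)
  rw [h1] at h2
  simp only [h2]
  congr 2
  abel

lemma Indep.fderiv_dir {F : Type*} [NormedAddCommGroup F] [NormedSpace ℝ F]
    {f : (Fin n → EuclideanSpace ℝ (Fin d)) → F} {v : Fin n} (h : Indep f v)
    (Y : Fin n → EuclideanSpace ℝ (Fin d)) (β : Fin d) : fderiv ℝ f Y (dir v β) = 0 := by
  by_cases hf : DifferentiableAt ℝ f Y
  · rw [← hf.lineDeriv_eq_fderiv, lineDeriv]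
    have : (fun t : ℝ => f (Y + t • dir v β)) = fun _ => f Y := by
      funext t
      apply h
      intro k hk
      simp [dir, hk]
    rw [this]
    simp
  · rw [fderiv_zero_of_not_differentiableAt hf]; rfl

/-- pre-activation of layer `t+1`. -/
def pre (𝒜 : Matrix (Fin n) (Fin n) ℝ)
    (Ω W : EuclideanSpace ℝ (Fin d) →L[ℝ] EuclideanSpace ℝ (Fin d))
    (ψ : EuclideanSpace ℝ (Fin d) × EuclideanSpace ℝ (Fin d) → EuclideanSpace ℝ (Fin d))
    (h : (Fin n → EuclideanSpace ℝ (Fin d)) → Fin n → EuclideanSpace ℝ (Fin d))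
    (i : Fin n) (X : Fin n → EuclideanSpace ℝ (Fin d)) : EuclideanSpace ℝ (Fin d) :=
  Ω (h X i) + W (∑ j : Fin n, 𝒜 i j • ψ (h X i, h X j))

lemma mpnn_succ (σ : ℝ → ℝ) (𝒜 : Matrix (Fin n) (Fin n) ℝ)
    (Ω W : ℕ → EuclideanSpace ℝ (Fin d) →L[ℝ] EuclideanSpace ℝ (Fin d))
    (ψ : ℕ → EuclideanSpace ℝ (Fin d) × EuclideanSpace ℝ (Fin d) → EuclideanSpace ℝ (Fin d))
    (t : ℕ) (Y : Fin n → EuclideanSpace ℝ (Fin d)) (i : Fin n) :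
    mpnn σ 𝒜 Ω W ψ (t+1) Y i
      = act σ (pre 𝒜 (Ω (t+1)) (W (t+1)) (ψ (t+1)) (mpnn σ 𝒜 Ω W ψ t) i Y) := rfl

lemma pre_contDiff (𝒜 : Matrix (Fin n) (Fin n) ℝ)
    (Ω W : EuclideanSpace ℝ (Fin d) →L[ℝ] EuclideanSpace ℝ (Fin d))
    (ψ : EuclideanSpace ℝ (Fin d) × EuclideanSpace ℝ (Fin d) → EuclideanSpace ℝ (Fin d))
    (hψ : ContDiff ℝ 2 ψ)
    (h : (Fin n → EuclideanSpace ℝ (Fin d)) → Fin n → EuclideanSpace ℝ (Fin d))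
    (hh : ∀ i, ContDiff ℝ 2 (fun Y => h Y i)) (i : Fin n) :
    ContDiff ℝ 2 (pre 𝒜 Ω W ψ h i) := by
  unfold pre
  refine (Ω.contDiff.comp (hh i)).add (W.contDiff.comp (ContDiff.sum fun j _ => ?_))
  exact (hψ.comp ((hh i).prodMk (hh j))).const_smul (𝒜 i j)

lemma mpnn_contDiff (σ : ℝ → ℝ) (hσ : ContDiff ℝ 2 σ) (𝒜 : Matrix (Fin n) (Fin n) ℝ)
    (Ω W : ℕ → EuclideanSpace ℝ (Fin d) →L[ℝ] EuclideanSpace ℝ (Fin d))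
    (ψ : ℕ → EuclideanSpace ℝ (Fin d) × EuclideanSpace ℝ (Fin d) → EuclideanSpace ℝ (Fin d))
    (hψ : ∀ t, ContDiff ℝ 2 (ψ t)) (t : ℕ) (i : Fin n) :
    ContDiff ℝ 2 (fun Y => mpnn σ 𝒜 Ω W ψ t Y i) := by
  induction t generalizing i with
  | zero => exact contDiff_apply ℝ _ i
  | succ t ih =>
    simp only [mpnn_succ]
    rw [contDiff_euclidean]
    intro α
    have h1 := pre_contDiff 𝒜 (Ω (t+1)) (W (t+1)) (ψ (t+1)) (hψ _) _ ih i
    rw [contDiff_euclidean] at h1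
    exact hσ.comp (h1 α)

lemma pre_indep (G : SimpleGraph (Fin n)) (𝒜 : Matrix (Fin n) (Fin n) ℝ)
    (h𝒜 : ∀ i j, ¬ G.Adj i j → 𝒜 i j = 0)
    (Ω W : EuclideanSpace ℝ (Fin d) →L[ℝ] EuclideanSpace ℝ (Fin d))
    (ψ : EuclideanSpace ℝ (Fin d) × EuclideanSpace ℝ (Fin d) → EuclideanSpace ℝ (Fin d))
    (h : (Fin n → EuclideanSpace ℝ (Fin d)) → Fin n → EuclideanSpace ℝ (Fin d)) (i v : Fin n)
    (hi : Indep (fun Y => h Y i) v) (hj : ∀ j, G.Adj i j → Indep (fun Y => h Y j) v) :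
    Indep (pre 𝒜 Ω W ψ h i) v := by
  intro Y Yb hY
  unfold pre
  have e1 : h Y i = h Yb i := hi Y Yb hY
  rw [e1]
  congr 2
  refine Finset.sum_congr rfl fun j _ => ?_
  by_cases hij : G.Adj i j
  · have e2 : h Y j = h Yb j := hj j hij Y Yb hY
    rw [e2]
  · simp [h𝒜 i j hij]

lemma dist_adj {G : SimpleGraph (Fin n)} (hconn : G.Connected) {i j : Fin n} (hij : G.Adj i j)
    (v : Fin n) : G.dist i v ≤ G.dist j v + 1 := by
  have := hconn.dist_triangle (u := i) (v := j) (w := v)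
  rw [SimpleGraph.dist_eq_one_iff_adj.2 hij] at this
  omega

lemma mpnn_indep (G : SimpleGraph (Fin n)) (hconn : G.Connected) (σ : ℝ → ℝ)
    (𝒜 : Matrix (Fin n) (Fin n) ℝ) (h𝒜 : ∀ i j, ¬ G.Adj i j → 𝒜 i j = 0)
    (Ω W : ℕ → EuclideanSpace ℝ (Fin d) →L[ℝ] EuclideanSpace ℝ (Fin d))
    (ψ : ℕ → EuclideanSpace ℝ (Fin d) × EuclideanSpace ℝ (Fin d) → EuclideanSpace ℝ (Fin d))
    (t : ℕ) (i v : Fin n) (hiv : t < G.dist i v) :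
    Indep (fun Y => mpnn σ 𝒜 Ω W ψ t Y i) v := by
  induction t generalizing i with
  | zero =>
    intro Y Yb hY
    apply hY
    rintro rfl
    simp at hiv
  | succ t ih =>
    intro Y Yb hY
    simp only [mpnn_succ]
    rw [pre_indep G 𝒜 h𝒜 (Ω (t+1)) (W (t+1)) (ψ (t+1)) (mpnn σ 𝒜 Ω W ψ t) i v
      (ih i (by omega)) (fun j hij => ih j (by have := dist_adj hconn hij v; omega)) Y Yb hY]

/-- derivative of the pre-activation along a direction the node itself ignores. -/
lemma pre_fderiv (𝒜 : Matrix (Fin n) (Fin n) ℝ)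
    (Ω W : EuclideanSpace ℝ (Fin d) →L[ℝ] EuclideanSpace ℝ (Fin d))
    (ψ : EuclideanSpace ℝ (Fin d) × EuclideanSpace ℝ (Fin d) → EuclideanSpace ℝ (Fin d))
    (hψ : ContDiff ℝ 2 ψ)
    (h : (Fin n → EuclideanSpace ℝ (Fin d)) → Fin n → EuclideanSpace ℝ (Fin d))
    (hh : ∀ i, ContDiff ℝ 2 (fun Y => h Y i)) (i v : Fin n)
    (hi : Indep (fun Y => h Y i) v) (Y : Fin n → EuclideanSpace ℝ (Fin d)) (β : Fin d) :
    fderiv ℝ (pre 𝒜 Ω W ψ h i) Y (dir v β)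
      = W (∑ j, 𝒜 i j • fderiv ℝ (fun Z => ψ (h Z i, h Z j)) Y (dir v β)) := by
  have hd : ∀ j, HasFDerivAt (fun Z => h Z j) (fderiv ℝ (fun Z => h Z j) Y) Y := fun j =>
    ((hh j).differentiable (by norm_num) Y).hasFDerivAt
  have hp : ∀ j, HasFDerivAt (fun Z => ψ (h Z i, h Z j))
      (fderiv ℝ (fun Z => ψ (h Z i, h Z j)) Y) Y := fun j =>
    ((hψ.comp ((hh i).prodMk (hh j))).differentiable (by norm_num) Y).hasFDerivAt
  have h1 := (Ω.hasFDerivAt.comp Y (hd i)).add (W.hasFDerivAt.comp Y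
    (HasFDerivAt.fun_sum (u := Finset.univ) fun j _ => (hp j).const_smul (𝒜 i j)))
  have h2 : fderiv ℝ (pre 𝒜 Ω W ψ h i) Y = _ := h1.fderiv
  rw [h2]
  have := hi.fderiv_dir Y β
  simp [this]

lemma psi_fderiv_le (c₂ : ℝ)
    (ψ : EuclideanSpace ℝ (Fin d) × EuclideanSpace ℝ (Fin d) → EuclideanSpace ℝ (Fin d))
    (hψ : ContDiff ℝ 2 ψ) (hψ₂ : ∀ x y, ‖fderiv ℝ (fun z => ψ (x, z)) y‖ ≤ c₂)
    (h : (Fin n → EuclideanSpace ℝ (Fin d)) → Fin n → EuclideanSpace ℝ (Fin d))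
    (hh : ∀ i, ContDiff ℝ 2 (fun Y => h Y i)) (i j v : Fin n)
    (hi : Indep (fun Y => h Y i) v) (Y : Fin n → EuclideanSpace ℝ (Fin d)) (β : Fin d) :
    ‖fderiv ℝ (fun Z => ψ (h Z i, h Z j)) Y (dir v β)‖
      ≤ c₂ * ‖fderiv ℝ (fun Z => h Z j) Y (dir v β)‖ := by
  have hd : ∀ j, HasFDerivAt (fun Z => h Z j) (fderiv ℝ (fun Z => h Z j) Y) Y := fun j =>
    ((hh j).differentiable (by norm_num) Y).hasFDerivAt
  have hψd : HasFDerivAt ψ (fderiv ℝ ψ (h Y i, h Y j)) (h Y i, h Y j) :=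
    (hψ.differentiable (by norm_num) _).hasFDerivAt
  have h1 := hψd.comp Y ((hd i).prodMk (hd j))
  have h2 := hψd.comp (h Y j) (hasFDerivAt_prodMk_right (h Y i) (h Y j))
  have h1b : fderiv ℝ (fun Z => ψ (h Z i, h Z j)) Y = _ := h1.fderiv
  have h2b : fderiv ℝ (fun z => ψ (h Y i, z)) (h Y j) = _ := h2.fderiv
  have h3 : fderiv ℝ (fun Z => ψ (h Z i, h Z j)) Y (dir v β)
      = fderiv ℝ (fun z => ψ (h Y i, z)) (h Y j) (fderiv ℝ (fun Z => h Z j) Y (dir v β)) := by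
    rw [h1b, h2b]
    simp [hi.fderiv_dir Y β]
  rw [h3]
  exact ContinuousLinearMap.le_of_opNorm_le _ (hψ₂ _ _) _

lemma pre_bound (G : SimpleGraph (Fin n)) (𝒜 : Matrix (Fin n) (Fin n) ℝ)
    (h𝒜 : ∀ i j, ¬ G.Adj i j → 𝒜 i j = 0) (h𝒜0 : ∀ i j, 0 ≤ 𝒜 i j)
    (Ω W : EuclideanSpace ℝ (Fin d) →L[ℝ] EuclideanSpace ℝ (Fin d))
    (w : ℝ) (hw : 0 < w) (hW : ‖W‖ ≤ w)
    (c₂ : ℝ) (hc₂ : 0 < c₂)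
    (ψ : EuclideanSpace ℝ (Fin d) × EuclideanSpace ℝ (Fin d) → EuclideanSpace ℝ (Fin d))
    (hψ : ContDiff ℝ 2 ψ) (hψ₂ : ∀ x y, ‖fderiv ℝ (fun z => ψ (x, z)) y‖ ≤ c₂)
    (h : (Fin n → EuclideanSpace ℝ (Fin d)) → Fin n → EuclideanSpace ℝ (Fin d))
    (hh : ∀ i, ContDiff ℝ 2 (fun Y => h Y i)) (i v : Fin n)
    (hi : Indep (fun Y => h Y i) v) (Y : Fin n → EuclideanSpace ℝ (Fin d)) (β : Fin d) (t : ℕ)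
    (hb : ∀ j, G.Adj i j →
      ‖fderiv ℝ (fun Z => h Z j) Y (dir v β)‖ ≤ (c₂ * w) ^ t * (𝒜 ^ t) j v) :
    ‖fderiv ℝ (pre 𝒜 Ω W ψ h i) Y (dir v β)‖ ≤ (c₂ * w) ^ (t+1) * (𝒜 ^ (t+1)) i v := by
  rw [pre_fderiv 𝒜 Ω W ψ hψ h hh i v hi Y β]
  have hs : ‖∑ j, 𝒜 i j • fderiv ℝ (fun Z => ψ (h Z i, h Z j)) Y (dir v β)‖
      ≤ ∑ j, 𝒜 i j * (c₂ * ((c₂ * w) ^ t * (𝒜 ^ t) j v)) := by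
    refine norm_sum_le_of_le _ fun j _ => ?_
    rw [norm_smul, Real.norm_eq_abs, abs_of_nonneg (h𝒜0 i j)]
    by_cases hij : G.Adj i j
    · refine mul_le_mul_of_nonneg_left ?_ (h𝒜0 i j)
      refine (psi_fderiv_le c₂ ψ hψ hψ₂ h hh i j v hi Y β).trans ?_
      exact mul_le_mul_of_nonneg_left (hb j hij) hc₂.le
    · simp [h𝒜 i j hij]
  refine (ContinuousLinearMap.le_of_opNorm_le _ hW _).trans
    ((mul_le_mul_of_nonneg_left hs hw.le).trans (le_of_eq ?_))
  rw [pow_succ' 𝒜, Matrix.mul_apply, Finset.mul_sum, Finset.mul_sum]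
  refine Finset.sum_congr rfl fun j _ => ?_
  ring

lemma coord_fderiv {f : (Fin n → EuclideanSpace ℝ (Fin d)) → EuclideanSpace ℝ (Fin d)}
    {Y : Fin n → EuclideanSpace ℝ (Fin d)} (hf : DifferentiableAt ℝ f Y) (α : Fin d) :
    HasFDerivAt (fun Z => f Z α) ((EuclideanSpace.proj α).comp (fderiv ℝ f Y)) Y :=
  (EuclideanSpace.proj (𝕜 := ℝ) α).hasFDerivAt.comp Y hf.hasFDerivAt

lemma act_fderiv {σ : ℝ → ℝ} (hσ : ContDiff ℝ 2 σ)
    {f : (Fin n → EuclideanSpace ℝ (Fin d)) → EuclideanSpace ℝ (Fin d)}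
    (hf : ContDiff ℝ 2 f) (Y a : Fin n → EuclideanSpace ℝ (Fin d)) (α : Fin d) :
    fderiv ℝ (fun Z => act σ (f Z) α) Y a = deriv σ (f Y α) * fderiv ℝ f Y a α := by
  have h1 : HasDerivAt σ (deriv σ (f Y α)) (f Y α) :=
    (hσ.differentiable (by norm_num) _).hasDerivAt
  have h2 := h1.comp_hasFDerivAt Y (coord_fderiv (hf.differentiable (by norm_num) Y) α)
  have h3 : fderiv ℝ (fun Z => act σ (f Z) α) Y = _ := h2.fderiv
  rw [h3]
  simp

lemma mpnn_bound (G : SimpleGraph (Fin n)) (hconn : G.Connected) (𝒜 : Matrix (Fin n) (Fin n) ℝ)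
    (h𝒜 : ∀ i j, ¬ G.Adj i j → 𝒜 i j = 0) (h𝒜0 : ∀ i j, 0 ≤ 𝒜 i j)
    (σ : ℝ → ℝ) (hσ : ContDiff ℝ 2 σ) (hσ' : ∀ x, |deriv σ x| ≤ 1)
    (Ω W : ℕ → EuclideanSpace ℝ (Fin d) →L[ℝ] EuclideanSpace ℝ (Fin d))
    (w : ℝ) (hw : 0 < w) (hW : ∀ t, ‖W t‖ ≤ w)
    (c₂ : ℝ) (hc₂ : 0 < c₂)
    (ψ : ℕ → EuclideanSpace ℝ (Fin d) × EuclideanSpace ℝ (Fin d) → EuclideanSpace ℝ (Fin d))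
    (hψ : ∀ t, ContDiff ℝ 2 (ψ t)) (hψ₂ : ∀ t x y, ‖fderiv ℝ (fun z => ψ t (x, z)) y‖ ≤ c₂)
    (v : Fin n) (Y : Fin n → EuclideanSpace ℝ (Fin d)) (β : Fin d) (t : ℕ) (i : Fin n)
    (hiv : t ≤ G.dist i v) :
    ‖fderiv ℝ (fun Z => mpnn σ 𝒜 Ω W ψ t Z i) Y (dir v β)‖ ≤ (c₂ * w) ^ t * (𝒜 ^ t) i v := by
  induction t generalizing i with
  | zero =>
    have h1 : fderiv ℝ (fun Z : Fin n → EuclideanSpace ℝ (Fin d) => mpnn σ 𝒜 Ω W ψ 0 Z i) Y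
      = ContinuousLinearMap.proj i := (ContinuousLinearMap.proj (R := ℝ)
        (φ := fun _ : Fin n => EuclideanSpace ℝ (Fin d)) i).fderiv
    rw [h1]
    by_cases hi : i = v
    · subst hi; simp [dir]
    · simp [dir, hi]
  | succ t ih =>
    have hh := mpnn_contDiff σ hσ 𝒜 Ω W ψ hψ t
    have hp := pre_contDiff 𝒜 (Ω (t+1)) (W (t+1)) (ψ (t+1)) (hψ _) _ hh i
    have hb := pre_bound G 𝒜 h𝒜 h𝒜0 (Ω (t+1)) (W (t+1)) w hw (hW _) c₂ hc₂ (ψ (t+1)) (hψ _)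
      (hψ₂ _) _ hh i v (mpnn_indep G hconn σ 𝒜 h𝒜 Ω W ψ t i v (by omega)) Y β t
      (fun j hij => ih j (by have := dist_adj hconn hij v; omega))
    refine le_trans ?_ hb
    have hd := (mpnn_contDiff σ hσ 𝒜 Ω W ψ hψ (t+1) i).differentiable (by norm_num) Y
    rw [EuclideanSpace.norm_eq, EuclideanSpace.norm_eq]
    apply Real.sqrt_le_sqrt
    refine Finset.sum_le_sum fun α _ => ?_
    have e1 := congrArg (fun L => L (dir v β)) (coord_fderiv hd α).fderiv
    have e2 := act_fderiv hσ hp Y (dir v β) α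
    simp only [mpnn_succ] at e1
    rw [e2] at e1
    have e3 : (fderiv ℝ (fun Z => mpnn σ 𝒜 Ω W ψ (t+1) Z i) Y (dir v β)) α
      = deriv σ (pre 𝒜 (Ω (t+1)) (W (t+1)) (ψ (t+1)) (mpnn σ 𝒜 Ω W ψ t) i Y α) *
        fderiv ℝ (pre 𝒜 (Ω (t+1)) (W (t+1)) (ψ (t+1)) (mpnn σ 𝒜 Ω W ψ t) i) Y (dir v β) α :=
      e1.symm
    rw [e3, norm_mul]
    have := hσ' (pre 𝒜 (Ω (t+1)) (W (t+1)) (ψ (t+1)) (mpnn σ 𝒜 Ω W ψ t) i Y α)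
    refine pow_le_pow_left₀ (by positivity) ?_ 2
    exact mul_le_of_le_one_left (norm_nonneg _) this

/-- second derivative of `act σ ∘ f` if the mixed second derivative of `f` vanishes. -/
lemma act_fderiv2 {σ : ℝ → ℝ} (hσ : ContDiff ℝ 2 σ)
    {f : (Fin n → EuclideanSpace ℝ (Fin d)) → EuclideanSpace ℝ (Fin d)}
    (hf : ContDiff ℝ 2 f) (X a : Fin n → EuclideanSpace ℝ (Fin d)) (v : Fin n) (α γ : Fin d)
    (hi : Indep (fun Y => fderiv ℝ f Y a) v) :
    fderiv ℝ (fun Y => fderiv ℝ (fun Z => act σ (f Z) γ) Y a) X (dir v α)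
      = deriv (deriv σ) (f X γ) * fderiv ℝ f X (dir v α) γ * fderiv ℝ f X a γ := by
  simp only [act_fderiv hσ hf]
  have hσd : ContDiff ℝ 1 (deriv σ) := by
    have : ContDiff ℝ (1 + 1) σ := by simpa [one_add_one_eq_two] using hσ
    exact (contDiff_succ_iff_deriv.1 this).2.2
  have h1 : HasDerivAt (deriv σ) (deriv (deriv σ) (f X γ)) (f X γ) :=
    (hσd.differentiable (by norm_num) _).hasDerivAt
  have h2 := h1.comp_hasFDerivAt X (coord_fderiv (hf.differentiable (by norm_num) X) γ)
  have hk : ContDiff ℝ 1 (fun Y => fderiv ℝ f Y a) :=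
    (hf.fderiv_right (m := 1) (by norm_num [one_add_one_eq_two])).clm_apply contDiff_const
  have h3 := coord_fderiv (hk.differentiable (by norm_num) X) γ
  have h4 : fderiv ℝ (fun Y => deriv σ (f Y γ) * fderiv ℝ f Y a γ) X = _ := (h2.mul h3).fderiv
  rw [h4]
  simp [hi.fderiv_dir X α]
  ring

lemma Asym_apply (G : SimpleGraph (Fin n)) [DecidableRel G.Adj] (i j : Fin n) :
    Asym G i j = (Real.sqrt (G.degree i))⁻¹ * (if G.Adj i j then 1 else 0)
      * (Real.sqrt (G.degree j))⁻¹ := by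
  rw [Asym, Matrix.mul_diagonal, Matrix.diagonal_mul, SimpleGraph.adjMatrix_apply]

lemma Asym_isSymm (G : SimpleGraph (Fin n)) [DecidableRel G.Adj] : (Asym G).transpose = Asym G := by
  ext i j
  rw [Matrix.transpose_apply, Asym_apply, Asym_apply]
  simp only [G.adj_comm i j]
  ring

lemma matPow_nonneg (𝒜 : Matrix (Fin n) (Fin n) ℝ) (h𝒜0 : ∀ i j, 0 ≤ 𝒜 i j) (t : ℕ) (i j : Fin n) :
    0 ≤ (𝒜 ^ t) i j := by
  induction t generalizing i with
  | zero => rw [pow_zero, Matrix.one_apply]; split_ifs <;> norm_num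
  | succ t ih =>
    rw [pow_succ', Matrix.mul_apply]
    exact Finset.sum_nonneg fun k _ => mul_nonneg (h𝒜0 _ _) (ih _)

/-- with `𝒜 = A_sym`, depth `m = r/2` where `r = d_G(v,u)` is even,
the mixing among `v,u` is bounded by `(c₂ w)^r (A_sym^r)_{vu}`. -/
theorem shallow_mixing_bound
    (G : SimpleGraph (Fin n)) [DecidableRel G.Adj] (hconn : G.Connected)
    (σ : ℝ → ℝ) (hσ : ContDiff ℝ 2 σ)
    (hσ' : ∀ x, |deriv σ x| ≤ 1) (hσ'' : ∀ x, |deriv (deriv σ) x| ≤ 1)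
    (Ω W : ℕ → EuclideanSpace ℝ (Fin d) →L[ℝ] EuclideanSpace ℝ (Fin d))
    (ω w : ℝ) (hw : 0 < w) (hΩ : ∀ t, ‖Ω t‖ ≤ ω) (hW : ∀ t, ‖W t‖ ≤ w)
    (ψ : ℕ → EuclideanSpace ℝ (Fin d) × EuclideanSpace ℝ (Fin d) → EuclideanSpace ℝ (Fin d))
    (hψ : ∀ t, ContDiff ℝ 2 (ψ t)) (c₁ c₂ c2 : ℝ) (hc₂ : 0 < c₂)
    (hψ₁ : ∀ t x y, ‖fderiv ℝ (fun z => ψ t (z, y)) x‖ ≤ c₁)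
    (hψ₂ : ∀ t x y, ‖fderiv ℝ (fun z => ψ t (x, z)) y‖ ≤ c₂)
    (hψ₃ : ∀ t p, ‖iteratedFDeriv ℝ 2 (ψ t) p‖ ≤ c2)
    (θ : EuclideanSpace ℝ (Fin d)) (hθ : ‖θ‖ = 1)
    (v u : Fin n) (r : ℕ) (hr : r = G.dist v u) (hrpos : 0 < r) (hreven : Even r)
    (m : ℕ) (hm : m = r / 2)
    (X : Fin n → EuclideanSpace ℝ (Fin d)) (α β : Fin d) :
    |OSQ.mixEntry θ σ (Asym G) Ω W ψ m v u X α β| ≤ (c₂ * w) ^ r * ((Asym G ^ r) v u) := by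
  obtain ⟨mb, hmb⟩ := hreven
  obtain ⟨t, rfl⟩ : ∃ t, m = t + 1 := ⟨m - 1, by omega⟩
  have hr2 : r = (t+1) + (t+1) := by omega
  have h𝒜 : ∀ i j, ¬ G.Adj i j → Asym G i j = 0 := fun i j hij => by
    rw [Asym_apply]; simp [hij]
  have h𝒜0 : ∀ i j, 0 ≤ Asym G i j := fun i j => by
    rw [Asym_apply]; split_ifs <;> positivity
  have hs := Asym_isSymm G
  generalize Asym G = 𝒜 at *
  have hC := mpnn_contDiff σ hσ 𝒜 Ω W ψ hψ
  have hCc : ∀ s i γ, ContDiff ℝ 2 (fun Z => mpnn σ 𝒜 Ω W ψ s Z i γ) := fun s i γ =>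
    (contDiff_euclidean.1 (hC s i)) γ
  have hP := fun i => pre_contDiff 𝒜 (Ω (t+1)) (W (t+1)) (ψ (t+1)) (hψ _) _ (hC t) i
  have hI := mpnn_indep G hconn σ 𝒜 h𝒜 Ω W ψ
  -- expand the readout
  have e0 : (fun Z => readout θ σ 𝒜 Ω W ψ (t+1) Z)
      = fun Z => ∑ γ : Fin d, ∑ i : Fin n, θ γ * mpnn σ 𝒜 Ω W ψ (t+1) Z i γ := by
    funext Z
    simp [readout, Finset.mul_sum]
  have e1 : ∀ Y, fderiv ℝ (fun Z => readout θ σ 𝒜 Ω W ψ (t+1) Z) Y (dir u β)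
      = ∑ γ : Fin d, ∑ i : Fin n,
        θ γ * fderiv ℝ (fun Z => mpnn σ 𝒜 Ω W ψ (t+1) Z i γ) Y (dir u β) := by
    intro Y
    rw [e0]
    have := HasFDerivAt.fun_sum (u := Finset.univ) fun (γ : Fin d) _ =>
      HasFDerivAt.fun_sum (u := Finset.univ) fun (i : Fin n) _ =>
      ((hCc (t+1) i γ).differentiable (by norm_num) Y).hasFDerivAt.const_mul (θ γ)
    rw [this.fderiv]
    simp
  have e2 : OSQ.mixEntry θ σ 𝒜 Ω W ψ (t+1) v u X α β
      = ∑ γ : Fin d, ∑ i : Fin n, θ γ * hessEntry σ 𝒜 Ω W ψ (t+1) i v u X γ α β := by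
    unfold mixEntry hessEntry
    simp only [e1]
    have hk : ∀ i γ, ContDiff ℝ 1
        (fun Y => fderiv ℝ (fun Z => mpnn σ 𝒜 Ω W ψ (t+1) Z i γ) Y (dir u β)) := fun i γ =>
      ((hCc (t+1) i γ).fderiv_right (m := 1) (by norm_num [one_add_one_eq_two])).clm_apply
        contDiff_const
    have := HasFDerivAt.fun_sum (u := Finset.univ) fun (γ : Fin d) _ =>
      HasFDerivAt.fun_sum (u := Finset.univ) fun (i : Fin n) _ =>
      ((hk i γ).differentiable (by norm_num) X).hasFDerivAt.const_mul (θ γ)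
    rw [this.fderiv]
    simp
  have key : ∀ i, ∑ γ : Fin d, |θ γ * hessEntry σ 𝒜 Ω W ψ (t+1) i v u X γ α β|
      ≤ ((c₂ * w) ^ (t+1) * (𝒜 ^ (t+1)) i v) * ((c₂ * w) ^ (t+1) * (𝒜 ^ (t+1)) i u) := by
    intro i
    have hnn : ∀ x, 0 ≤ (c₂ * w) ^ (t+1) * (𝒜 ^ (t+1)) i x := fun x =>
      mul_nonneg (by positivity) (matPow_nonneg 𝒜 h𝒜0 _ _ _)
    have hzero : (∀ γ, hessEntry σ 𝒜 Ω W ψ (t+1) i v u X γ α β = 0) →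
        ∑ γ : Fin d, |θ γ * hessEntry σ 𝒜 Ω W ψ (t+1) i v u X γ α β|
      ≤ ((c₂ * w) ^ (t+1) * (𝒜 ^ (t+1)) i v) * ((c₂ * w) ^ (t+1) * (𝒜 ^ (t+1)) i u) := by
      intro h0
      simp only [h0, mul_zero, abs_zero, Finset.sum_const_zero]
      exact mul_nonneg (hnn _) (hnn _)
    have hcoord : ∀ x γ, Indep (fun Y => mpnn σ 𝒜 Ω W ψ (t+1) Y i) x →
        Indep (fun Y => mpnn σ 𝒜 Ω W ψ (t+1) Y i γ) x := fun x γ h Y Yb hY =>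
      congrArg (fun z : EuclideanSpace ℝ (Fin d) => z γ) (h Y Yb hY)
    by_cases hv : t + 1 < G.dist i v
    · exact hzero fun γ => ((hcoord v γ (hI _ _ _ hv)).fderiv_apply _).fderiv_dir X α
    by_cases hu : t + 1 < G.dist i u
    · refine hzero fun γ => ?_
      unfold hessEntry
      simp only [(hcoord u γ (hI _ _ _ hu)).fderiv_dir]
      simp
    have htri : ∀ j, r ≤ G.dist j v + G.dist j u := fun j => by
      rw [hr, G.dist_comm (u := j) (v := v)]
      exact hconn.dist_triangle
    have hti := htri i
    have hiv := hI t i v (by omega)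
    have hiu := hI t i u (by omega)
    have hind : Indep (fun Y => fderiv ℝ
        (pre 𝒜 (Ω (t+1)) (W (t+1)) (ψ (t+1)) (mpnn σ 𝒜 Ω W ψ t) i) Y (dir u β)) v := by
      simp only [pre_fderiv 𝒜 (Ω (t+1)) (W (t+1)) (ψ (t+1)) (hψ _) _ (hC t) i u hiu]
      intro Y Yb hY
      simp only
      congr 1
      refine Finset.sum_congr rfl fun j _ => ?_
      congr 1
      have htj := htri j
      have hmk : ∀ x, Indep (fun Y => mpnn σ 𝒜 Ω W ψ t Y i) x →
          Indep (fun Y => mpnn σ 𝒜 Ω W ψ t Y j) x →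
          Indep (fun Z => ψ (t+1) (mpnn σ 𝒜 Ω W ψ t Z i, mpnn σ 𝒜 Ω W ψ t Z j)) x := by
        intro x h1 h2 Z Zb hZ
        have e1 : mpnn σ 𝒜 Ω W ψ t Z i = mpnn σ 𝒜 Ω W ψ t Zb i := h1 Z Zb hZ
        have e2 : mpnn σ 𝒜 Ω W ψ t Z j = mpnn σ 𝒜 Ω W ψ t Zb j := h2 Z Zb hZ
        simp only [e1, e2]
      by_cases hjv : t < G.dist j v
      · exact (hmk v hiv (hI t j v hjv)).fderiv_apply _ Y Yb hY
      · have := hmk u hiu (hI t j u (by omega))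
        rw [this.fderiv_dir, this.fderiv_dir]
    have hb : ∀ x δ, t + 1 ≤ G.dist i x → Indep (fun Y => mpnn σ 𝒜 Ω W ψ t Y i) x →
        ‖fderiv ℝ (pre 𝒜 (Ω (t+1)) (W (t+1)) (ψ (t+1)) (mpnn σ 𝒜 Ω W ψ t) i) X (dir x δ)‖
        ≤ (c₂ * w) ^ (t+1) * (𝒜 ^ (t+1)) i x := fun x δ hx hix =>
      pre_bound G 𝒜 h𝒜 h𝒜0 (Ω (t+1)) (W (t+1)) w hw (hW _) c₂ hc₂ (ψ (t+1)) (hψ _)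
        (hψ₂ _) _ (hC t) i x hix X δ t fun j hij =>
        mpnn_bound G hconn 𝒜 h𝒜 h𝒜0 σ hσ hσ' Ω W w hw hW c₂ hc₂ ψ hψ hψ₂ x X δ t j
          (by have := dist_adj hconn hij x; omega)
    refine le_trans ?_ (mul_le_mul (hb v α (by omega) hiv) (hb u β (by omega) hiu)
      (norm_nonneg _) (hnn v))
    have hess : ∀ γ, hessEntry σ 𝒜 Ω W ψ (t+1) i v u X γ α β = _ := fun γ =>
      act_fderiv2 hσ (hP i) X (dir u β) v α γ hind
    simp only [hess]
    generalize fderiv ℝ (pre 𝒜 (Ω (t+1)) (W (t+1)) (ψ (t+1)) (mpnn σ 𝒜 Ω W ψ t) i) X (dir v α) = p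
    generalize fderiv ℝ (pre 𝒜 (Ω (t+1)) (W (t+1)) (ψ (t+1)) (mpnn σ 𝒜 Ω W ψ t) i) X (dir u β) = q
    rw [EuclideanSpace.norm_eq, EuclideanSpace.norm_eq]
    refine le_trans (Finset.sum_le_sum fun γ _ => ?_)
      (Real.sum_mul_le_sqrt_mul_sqrt Finset.univ (fun γ => ‖p γ‖) (fun γ => ‖q γ‖))
    have hθγ : |θ γ| ≤ 1 := hθ ▸ PiLp.norm_apply_le θ γ
    have h2 := hσ'' (pre 𝒜 (Ω (t+1)) (W (t+1)) (ψ (t+1)) (mpnn σ 𝒜 Ω W ψ t) i X γ)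
    simp only [abs_mul, Real.norm_eq_abs]
    calc _ = (|θ γ| * |deriv (deriv σ)
          (pre 𝒜 (Ω (t+1)) (W (t+1)) (ψ (t+1)) (mpnn σ 𝒜 Ω W ψ t) i X γ)|) * (|p γ| * |q γ|) := by
          ring
      _ ≤ 1 * (|p γ| * |q γ|) :=
          mul_le_mul_of_nonneg_right (mul_le_one₀ hθγ (abs_nonneg _) h2) (by positivity)
      _ = _ := one_mul _
  rw [e2, Finset.sum_comm]
  refine (Finset.abs_sum_le_sum_abs _ _).trans ((Finset.sum_le_sum fun i _ =>
    (Finset.abs_sum_le_sum_abs _ _).trans (key i)).trans (le_of_eq ?_))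
  rw [hr2, pow_add 𝒜 (t+1) (t+1), Matrix.mul_apply, Finset.mul_sum]
  refine Finset.sum_congr rfl fun i _ => ?_
  have : (𝒜 ^ (t+1)) v i = (𝒜 ^ (t+1)) i v := by
    rw [← Matrix.transpose_apply (𝒜 ^ (t+1)) i v, Matrix.transpose_pow, hs]
  rw [this]
  ring
end OSQ
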